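/- The explicit function S₀ solves the linearized bubble equation: S₀(0) = 0 and, for every r > 0, S₀″(r) + S₀′(r)/r + 8(1+r²)^{−2}·S₀(r) = 4(1+r²)^{−2}·(T₀(r) − T₀(r)²). (Equivalently, with the geometer's Laplacian Δ = −(d²/dr² + r⁻¹ d/dr) acting on radial functions, ΔS₀ − 8·exp(−2T₀)·S₀ = 4·exp(−2T₀)·(T₀² − T₀).) -/

import Mathlib

open MeasureTheory

/-- `T₀(r) = log(1 + r²)`. -/
noncomputable def T0 (r : ℝ) : ℝ := Real.log (1 + r ^ 2)

/-- The explicit second-order bubble correction `S₀`. -/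
noncomputable def S0 (r : ℝ) : ℝ :=
  -T0 r + 2 * r ^ 2 / (1 + r ^ 2) - T0 r ^ 2 / 2 +
    ((1 - r ^ 2) / (1 + r ^ 2)) * ∫ t in (1 : ℝ)..(1 + r ^ 2), Real.log t / (1 - t)

lemma measurable_log_div_one_sub : Measurable fun t : ℝ => Real.log t / (1 - t) :=
  Real.measurable_log.div (measurable_const.sub measurable_id)

lemma abs_log_div_one_sub_le_one {t : ℝ} (ht : 1 ≤ t) : |Real.log t / (1 - t)| ≤ 1 := by
  rw [abs_div, abs_of_nonneg (Real.log_nonneg ht), abs_of_nonpos (by linarith)]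
  exact div_le_one_of_le₀ (by linarith [Real.log_le_sub_one_of_pos (by linarith : 0 < t)])
    (by linarith)

lemma intervalIntegrable_log_div_one_sub {u : ℝ} (hu : 1 ≤ u) :
    IntervalIntegrable (fun t : ℝ => Real.log t / (1 - t)) volume 1 u := by
  refine (intervalIntegrable_const (c := (1 : ℝ))).mono_fun
    measurable_log_div_one_sub.aestronglyMeasurable ?_
  filter_upwards [ae_restrict_mem measurableSet_uIoc] with t ht
  rw [Set.uIoc_of_le hu] at ht
  simpa [abs_div] using abs_log_div_one_sub_le_one ht.1.le

lemma hasDerivAt_integral_log_div_one_sub {u : ℝ} (hu : 1 < u) :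
    HasDerivAt (fun x : ℝ => ∫ t in (1 : ℝ)..x, Real.log t / (1 - t))
      (Real.log u / (1 - u)) u := by
  refine intervalIntegral.integral_hasDerivAt_right
    (intervalIntegrable_log_div_one_sub hu.le)
    measurable_log_div_one_sub.stronglyMeasurable.stronglyMeasurableAtFilter ?_
  exact (Real.continuousAt_log (by linarith)).div (by fun_prop) (by linarith)

lemma hasDerivAt_one_add_sq (r : ℝ) : HasDerivAt (fun x : ℝ => 1 + x ^ 2) (2 * r) r := by
  simpa using (hasDerivAt_pow 2 r).const_add 1

lemma hasDerivAt_T0 (r : ℝ) : HasDerivAt T0 (2 * r / (1 + r ^ 2)) r :=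
  (hasDerivAt_one_add_sq r).log (by positivity)

lemma hasDerivAt_integral_one_add_sq {r : ℝ} (hr : 0 < r) :
    HasDerivAt (fun x : ℝ => ∫ t in (1 : ℝ)..(1 + x ^ 2), Real.log t / (1 - t))
      (-2 * T0 r / r) r := by
  have hu : 1 < 1 + r ^ 2 := by nlinarith
  refine ((hasDerivAt_integral_log_div_one_sub hu).comp r
    (hasDerivAt_one_add_sq r)).congr_deriv ?_
  rw [T0, show 1 - (1 + r ^ 2) = -r ^ 2 by ring]
  field_simp

lemma hasDerivAt_S0 {r : ℝ} (hr : 0 < r) :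
    HasDerivAt S0
      (-(2 * r / (1 + r ^ 2)) + 4 * r / (1 + r ^ 2) ^ 2 - 2 * r * T0 r / (1 + r ^ 2)
        - 4 * r / (1 + r ^ 2) ^ 2 * (∫ t in (1 : ℝ)..(1 + r ^ 2), Real.log t / (1 - t))
        - 2 * (1 - r ^ 2) * T0 r / (r * (1 + r ^ 2))) r := by
  have hu : 1 + r ^ 2 ≠ 0 := by positivity
  have hsq := hasDerivAt_pow 2 r
  have hU := hasDerivAt_one_add_sq r
  have hT := hasDerivAt_T0 r
  refine (((hT.neg.add ((hsq.const_mul 2).div hU hu)).sub ((hT.pow 2).div_const 2)).add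
    (((hsq.const_sub 1).div hU hu).mul (hasDerivAt_integral_one_add_sq hr))).congr_deriv ?_
  simp only [Pi.div_apply]
  generalize (∫ t in (1 : ℝ)..(1 + r ^ 2), Real.log t / (1 - t)) = J
  field_simp
  push_cast
  ring

lemma hasDerivAt_deriv_S0 {r : ℝ} (hr : 0 < r) :
    HasDerivAt (deriv S0)
      (4 * (T0 r - T0 r ^ 2) / (1 + r ^ 2) ^ 2 - 8 * S0 r / (1 + r ^ 2) ^ 2 - deriv S0 r / r)
      r := by
  have hu : 1 + r ^ 2 ≠ 0 := by positivity
  have hid := hasDerivAt_id r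
  have hsq := hasDerivAt_pow 2 r
  have hU := hasDerivAt_one_add_sq r
  have hT := hasDerivAt_T0 r
  have hA := (hid.const_mul 4).div (hU.pow 2) (pow_ne_zero 2 hu)
  have hderiv := (((((hid.const_mul 2).div hU hu).neg.add hA).sub
    (((hid.const_mul 2).mul hT).div hU hu)).sub
    (hA.mul (hasDerivAt_integral_one_add_sq hr))).sub
    ((((hsq.const_sub 1).const_mul 2).mul hT).div (hid.mul hU) (mul_ne_zero hr.ne' hu))
  have heq : deriv S0 =ᶠ[nhds r] _ :=
    (eventually_gt_nhds hr).mono fun x hx => (hasDerivAt_S0 hx).deriv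
  refine (hderiv.congr_of_eventuallyEq heq).congr_deriv ?_
  rw [(hasDerivAt_S0 hr).deriv, S0]
  simp only [Pi.div_apply, Pi.mul_apply, Pi.pow_apply, id]
  generalize (∫ t in (1 : ℝ)..(1 + r ^ 2), Real.log t / (1 - t)) = J
  field_simp
  push_cast
  ring

/-- The explicit function `S₀` solves the linearized bubble equation: `S₀(0) = 0` and,
for every `r > 0`,
`S₀″(r) + S₀′(r)/r + 8(1+r²)⁻²·S₀(r) = 4(1+r²)⁻²·(T₀(r) − T₀(r)²)`. -/
theorem S0_solves_linearized_bubble_equation :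
    S0 0 = 0 ∧ ∀ r > (0 : ℝ),
      deriv (deriv S0) r + deriv S0 r / r + 8 * S0 r / (1 + r ^ 2) ^ 2
        = 4 * (T0 r - T0 r ^ 2) / (1 + r ^ 2) ^ 2 := by
  refine ⟨by simp [S0, T0], fun r hr => ?_⟩
  rw [(hasDerivAt_deriv_S0 hr).deriv]
  ring
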